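/- arXiv:1606.06208 — 2 statements merged into one kernel-verified Lean document; each statement's English description precedes it below -/
import Mathlib

section
/- Let R ∈ SO(3) with |R|_I < 1 and let A be a symmetric real 3×3 matrix such that Ā = (tr(A)I − A)/2 is positive definite. Then ψ(AR) = (2/(1 + ‖Z(R)‖²)) (I − [Z(R)]_×) Ā Z(R). -/
open Matrix Filter

noncomputable section

attribute [local instance] Matrix.normedAddCommGroup Matrix.normedSpace

/-- 3×3 real matrices. -/
abbrev M3 := Matrix (Fin 3) (Fin 3) ℝ
/-- vectors in ℝ³. -/
abbrev V3 := Fin 3 → ℝ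

/-- `R ∈ SO(3)`: `RᵀR = I` and `det R = 1`. -/
def SO3 (R : M3) : Prop := Rᵀ * R = 1 ∧ R.det = 1

/-- The skew-symmetric matrix `[x]ₓ` with `[x]ₓ y = x × y`. -/
def skew (x : V3) : M3 :=
  !![0, -x 2, x 1; x 2, 0, -x 0; -x 1, x 0, 0]

/-- Inverse of `skew` on skew-symmetric matrices. -/
def vex (M : M3) : V3 := ![M 2 1, M 0 2, M 1 0]

/-- Anti-symmetric projection `P_a(M) = (M - Mᵀ)/2`. -/
def Pa (M : M3) : M3 := (2:ℝ)⁻¹ • (M - Mᵀ)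

/-- `ψ(M) = vex(P_a(M))`. -/
def psi (M : M3) : V3 := vex (Pa M)

/-- Squared normalized Euclidean distance `|R|_I² = tr(I - R)/4`. -/
def normI2 (R : M3) : ℝ := (1 - R).trace / 4

/-- Rodrigues vector `Z(R) = ψ(R)/(2(1 - |R|_I²))`. -/
def Zof (R : M3) : V3 := (2 * (1 - normI2 R))⁻¹ • psi R

/-- Cayley map `R_r(z) = (I + [z]ₓ)(I - [z]ₓ)⁻¹`. -/
def Rr (z : V3) : M3 := (1 + skew z) * (1 - skew z)⁻¹

/-- Angle-axis map `R_a(θ,u) = I + sin θ [u]ₓ + (1 - cos θ)[u]ₓ²`. -/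
def Ra (θ : ℝ) (u : V3) : M3 :=
  1 + Real.sin θ • skew u + (1 - Real.cos θ) • (skew u * skew u)

/-- `g(z) = (1/2)(I + [z]ₓ + z zᵀ)`. -/
def gmat (z : V3) : M3 := (2:ℝ)⁻¹ • ((1 : M3) + skew z + vecMulVec z z)

/-- `Ā = (tr(A) I - A)/2`. -/
def Abar (A : M3) : M3 := (2:ℝ)⁻¹ • (A.trace • (1 : M3) - A)

/-- smallest eigenvalue of a positive-definite symmetric real matrix. -/
def lmin {B : M3} (hB : B.PosDef) : ℝ := ⨅ i, hB.1.eigenvalues i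

/-- largest eigenvalue of a positive-definite symmetric real matrix. -/
def lmax {B : M3} (hB : B.PosDef) : ℝ := ⨆ i, hB.1.eigenvalues i

/-- A matrix in `SO(3)` equals its own cofactor matrix. -/
theorem SO3.adjugate_eq {R : M3} (hR : SO3 R) : R.adjugate = Rᵀ := by
  have h : Rᵀ * R * R.adjugate = Rᵀ := by
    rw [Matrix.mul_assoc, mul_adjugate, hR.2, one_smul, Matrix.mul_one]
  rwa [hR.1, Matrix.one_mul] at h

theorem one_add_trace_pos {R : M3} (h : normI2 R < 1) : 0 < 1 + R.trace := by
  simp only [normI2, trace_sub, trace_one, Fintype.card_fin] at h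
  push_cast at h
  linarith

/-- The entries of the Rodrigues vector, cleared of denominators. -/
theorem one_add_trace_smul_Zof {R : M3} (h : normI2 R < 1) :
    (1 + R.trace) • Zof R = ![R 2 1 - R 1 2, R 0 2 - R 2 0, R 1 0 - R 0 1] := by
  have ht := (one_add_trace_pos h).ne'
  have hn : 2 * (1 - normI2 R) = (1 + R.trace) / 2 := by
    simp only [normI2, trace_sub, trace_one, Fintype.card_fin]
    push_cast
    ring
  rw [Zof, hn]
  ext i
  fin_cases i <;> simp [psi, vex, Pa] <;> field_simp

/-- `R + I` in terms of the axial vector `2 ψ(R)` and the trace of the rotation `R`. -/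
theorem SO3.smul_add_one_eq {R : M3} (hR : SO3 R) {p : V3}
    (hp : p = ![R 2 1 - R 1 2, R 0 2 - R 2 0, R 1 0 - R 0 1]) :
    (2 * (1 + R.trace)) • (R + 1) =
      (1 + R.trace) ^ 2 • (1 : M3) + (1 + R.trace) • skew p + vecMulVec p p := by
  have hadj := hR.adjugate_eq
  have hcol := hR.1
  have hrow := mul_eq_one_comm.mp hR.1
  rw [adjugate_fin_three] at hadj
  simp [← Matrix.ext_iff, Matrix.mul_apply, Fin.sum_univ_three, Fin.forall_fin_succ]
    at hadj hcol hrow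
  subst hp
  ext i j
  fin_cases i <;> fin_cases j <;>
    simp [skew, trace_fin_three] <;> grind

/-- The Cayley form of a rotation, `R + I = (1 + tr R) g(Z(R))`. -/
theorem SO3.add_one_eq {R : M3} (hR : SO3 R) (h : normI2 R < 1) :
    R + 1 = (1 + R.trace) • gmat (Zof R) := by
  have ht := (one_add_trace_pos h).ne'
  have key := hR.smul_add_one_eq (one_add_trace_smul_Zof h)
  rw [← Matrix.ext_iff] at key ⊢
  intro i j
  have hij := key i j
  apply mul_left_cancel₀ (mul_ne_zero two_ne_zero ht)
  simp only [Matrix.smul_apply, smul_eq_mul] at hij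
  rw [hij]
  fin_cases i <;> fin_cases j <;> simp [gmat, skew, vecMulVec_apply] <;> ring

theorem one_add_trace_mul_one_add_normSq {R : M3} (hR : SO3 R) (h : normI2 R < 1) :
    (1 + R.trace) * (1 + Zof R ⬝ᵥ Zof R) = 4 := by
  have key := congrArg trace (hR.add_one_eq h)
  simp [gmat, skew, trace_fin_three] at key
  rw [trace_fin_three]
  linear_combination -2 * key

/-- `ψ(A g(z)) = (1/2) (I - [z]ₓ) Ā z` for symmetric `A`. -/
theorem psi_mul_gmat {A : M3} (hA : A.IsSymm) (z : V3) :
    psi (A * gmat z) = (2 : ℝ)⁻¹ • ((1 - skew z) *ᵥ (Abar A *ᵥ z)) := by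
  have h10 := hA.apply 0 1
  have h20 := hA.apply 0 2
  have h21 := hA.apply 1 2
  ext i
  fin_cases i <;>
    simp [psi, vex, Pa, gmat, skew, Abar, vecMulVec_apply, Matrix.mul_apply, mulVec, dotProduct,
      Fin.sum_univ_three, trace_fin_three, h10, h20, h21] <;>
    ring

theorem psi_sub (M N : M3) : psi (M - N) = psi M - psi N := by
  ext i
  fin_cases i <;> simp [psi, vex, Pa] <;> ring

theorem psi_smul (c : ℝ) (M : M3) : psi (c • M) = c • psi M := by
  ext i
  fin_cases i <;> simp [psi, vex, Pa] <;> ring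

theorem psi_of_isSymm {A : M3} (hA : A.IsSymm) : psi A = 0 := by
  rw [psi, Pa, hA.eq]
  ext i
  fin_cases i <;> simp [vex]

/-- for `R ∈ SO(3)` with `|R|_I < 1`,
`ψ(AR) = (2/(1 + ‖Z(R)‖²)) (I − [Z(R)]ₓ) Ā Z(R)`. -/
theorem stmt3 (A : M3) (hA : A.IsSymm) (hPD : (Abar A).PosDef)
    (R : M3) (hR : SO3 R) (h1 : normI2 R < 1) :
    psi (A * R) =
      (2 / (1 + Zof R ⬝ᵥ Zof R)) •
        ((1 - skew (Zof R)) *ᵥ (Abar A *ᵥ Zof R)) := by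
  have hR' : A * R = (1 + R.trace) • (A * gmat (Zof R)) - A := by
    rw [← Matrix.mul_smul, ← hR.add_one_eq h1, Matrix.mul_add, Matrix.mul_one,
      add_sub_cancel_right]
  have hs := one_add_trace_mul_one_add_normSq hR h1
  have hs0 : 1 + Zof R ⬝ᵥ Zof R ≠ 0 := right_ne_zero_of_mul (hs ▸ four_ne_zero)
  rw [hR', psi_sub, psi_of_isSymm hA, sub_zero, psi_smul, psi_mul_gmat hA, smul_smul]
  congr 1
  field_simp
  linear_combination hs

end
end

section
/- Let A be a symmetric real 3×3 matrix such that Ā = (tr(A)I − A)/2 is positive definite, with smallest and largest eigenvalues λ_min and λ_max. Let ε > 0 and γ > 0 satisfy γ < (1+ε)^{−1/2}, and set ξ₀ = 1 − γ²ε/(1−γ²). Let R̃ : [0,∞) → ℝ^{3×3} be differentiable with R̃(t) ∈ SO(3) and R̃'(t) = R̃(t)[σ(t)]_×, where σ(t) = −ψ(A R̃(t)) / (1 + ε − |R̃(t)|_I²)^{1/2}, and suppose |R̃(0)|_I² < ξ₀. Then for all t ≥ 0, with s = |R̃(0)|_I: s/(cosh(λ_max t) + (1−s²)^{1/2} sinh(λ_max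 t)) ≤ |R̃(t)|_I ≤ s/(cosh(γ λ_min t) + (1−s²)^{1/2} sinh(γ λ_min t)). -/
open Matrix Filter

noncomputable section

attribute [local instance] Matrix.normedAddCommGroup Matrix.normedSpace

theorem SO3.entries {R : M3} (h : SO3 R) :
    (∀ i j, ∑ k, R k i * R k j = if i = j then 1 else 0) ∧
    (∀ i j, ∑ k, R i k * R j k = if i = j then 1 else 0) ∧
    R.adjugate = Rᵀ := by
  obtain ⟨h1, h2⟩ := h
  have h3 : R * Rᵀ = 1 := mul_eq_one_comm.mp h1
  refine ⟨fun i j => ?_, fun i j => ?_, ?_⟩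
  · simpa [Matrix.mul_apply, Matrix.one_apply] using congrFun (congrFun h1 i) j
  · simpa [Matrix.mul_apply, Matrix.one_apply] using congrFun (congrFun h3 i) j
  · calc R.adjugate = Rᵀ * R * R.adjugate := by rw [h1, one_mul]
      _ = Rᵀ := by rw [Matrix.mul_assoc, Matrix.mul_adjugate, h2]; simp

theorem SO3.psi_identities {R : M3} (h : SO3 R) {A : M3} (hA : A.IsSymm) :
    psi R ⬝ᵥ psi (A * R) = psi R ⬝ᵥ (Abar A *ᵥ psi R) ∧
    psi R ⬝ᵥ psi R = 4 * (normI2 R * (1 - normI2 R)) := by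
  obtain ⟨h1, h2, h3⟩ := h.entries
  have c : ∀ i j, R.adjugate i j = R j i := fun i j => by rw [h3]; rfl
  simp only [Matrix.adjugate_fin_three, Fin.forall_fin_succ, Fin.sum_univ_three] at c h1 h2
  simp at c h1 h2
  have a1 := hA.apply 0 1
  have a2 := hA.apply 0 2
  have a3 := hA.apply 1 2
  obtain ⟨⟨c1, c2, c3⟩, ⟨c4, c5, c6⟩, c7, c8, c9⟩ := c
  obtain ⟨⟨p1, p2, p3⟩, ⟨-, p5, p6⟩, -, -, p9⟩ := h1
  obtain ⟨⟨q1, q2, q3⟩, ⟨-, q5, q6⟩, -, -, q9⟩ := h2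
  have e00 : (R 0 2 - R 2 0) * R 0 2 - (R 1 0 - R 0 1) * R 0 1 =
      ((R 0 2 - R 2 0) ^ 2 + (R 1 0 - R 0 1) ^ 2) / 2 := by linarith
  have e11 : (R 1 0 - R 0 1) * R 1 0 - (R 2 1 - R 1 2) * R 1 2 =
      ((R 2 1 - R 1 2) ^ 2 + (R 1 0 - R 0 1) ^ 2) / 2 := by linarith
  have e22 : (R 2 1 - R 1 2) * R 2 1 - (R 0 2 - R 2 0) * R 2 0 =
      ((R 2 1 - R 1 2) ^ 2 + (R 0 2 - R 2 0) ^ 2) / 2 := by linarith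
  have e01 : -(R 2 1 - R 1 2) * R 0 2 + (R 0 2 - R 2 0) * R 1 2 +
      (R 1 0 - R 0 1) * (R 0 0 - R 1 1) = -((R 2 1 - R 1 2) * (R 0 2 - R 2 0)) := by linarith
  have e02 : (R 2 1 - R 1 2) * R 0 1 + (R 0 2 - R 2 0) * (R 2 2 - R 0 0) -
      (R 1 0 - R 0 1) * R 2 1 = -((R 2 1 - R 1 2) * (R 1 0 - R 0 1)) := by linarith
  have e12 : (R 2 1 - R 1 2) * (R 1 1 - R 2 2) - (R 0 2 - R 2 0) * R 1 0 +
      (R 1 0 - R 0 1) * R 2 0 = -((R 0 2 - R 2 0) * (R 1 0 - R 0 1)) := by linarith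
  simp [psi, vex, Pa, Abar, normI2, dotProduct, Matrix.mulVec, Fin.sum_univ_three,
    Matrix.mul_apply, Matrix.trace, a1, a2, a3]
  constructor
  · linear_combination (A 0 0 * e00 + A 1 1 * e11 + A 2 2 * e22 + A 0 1 * e01 + A 0 2 * e02 +
      A 1 2 * e12) / 4
  · linarith

theorem SO3.normI2_mem {R : M3} (h : SO3 R) : 0 ≤ normI2 R ∧ normI2 R ≤ 1 := by
  have h1 := (h.psi_identities (A := 1) Matrix.transpose_one).2
  have h2 : 0 ≤ psi R ⬝ᵥ psi R := by
    simpa using dotProduct_star_self_nonneg (psi R)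
  constructor <;> nlinarith

theorem trace_mul_skew (M : M3) (x : V3) : (M * skew x).trace = -2 * (psi M ⬝ᵥ x) := by
  simp [psi, vex, Pa, skew, dotProduct, Fin.sum_univ_three, Matrix.mul_apply, Matrix.trace]
  ring

theorem hasDerivWithinAt_normI2 {R : ℝ → M3} {D : M3} {s : Set ℝ} {t : ℝ}
    (h : HasDerivWithinAt R D s t) :
    HasDerivWithinAt (fun t => normI2 (R t)) (-D.trace / 4) s t := by
  have e (i j : Fin 3) : HasDerivWithinAt (fun t => R t i j) (D i j) s t :=
    hasDerivWithinAt_pi.1 (hasDerivWithinAt_pi.1 h i) j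
  have hn : (fun t => normI2 (R t)) = fun t => (3 - (R t 0 0 + R t 1 1 + R t 2 2)) / 4 := by
    funext t
    simp [normI2, Matrix.trace, Fin.sum_univ_three]
  have hD : -D.trace / 4 = -(D 0 0 + D 1 1 + D 2 2) / 4 := by
    simp [Matrix.trace, Fin.sum_univ_three]
  rw [hn, hD]
  exact ((((e 0 0).add (e 1 1)).add (e 2 2)).const_sub 3).div_const 4

theorem Matrix.IsHermitian.exists_sum_eigenvalues {n : Type*} [Fintype n] [DecidableEq n]
    {B : Matrix n n ℝ} (hB : B.IsHermitian) (v : n → ℝ) :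
    ∃ w : n → ℝ, v ⬝ᵥ (B *ᵥ v) = ∑ i, hB.eigenvalues i * w i ^ 2 ∧ v ⬝ᵥ v = ∑ i, w i ^ 2 := by
  set U : Matrix n n ℝ := hB.eigenvectorUnitary.1
  have hU : U * star U = 1 := Unitary.coe_mul_star_self hB.eigenvectorUnitary
  have hs : star U = Uᵀ := Matrix.conjTranspose_eq_transpose_of_trivial U
  have hS : B = U * diagonal hB.eigenvalues * star U := by
    conv_lhs => rw [hB.spectral_theorem, Unitary.conjStarAlgAut_apply]
    rfl
  refine ⟨Uᵀ *ᵥ v, ?_, ?_⟩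
  · conv_lhs => rw [hS, hs, ← mulVec_mulVec, ← mulVec_mulVec, dotProduct_mulVec,
      ← mulVec_transpose]
    simp only [dotProduct, mulVec_diagonal]
    exact Finset.sum_congr rfl fun i _ => by ring
  · have : v ⬝ᵥ v = v ⬝ᵥ (U *ᵥ (Uᵀ *ᵥ v)) := by rw [mulVec_mulVec, ← hs, hU, one_mulVec]
    rw [this, dotProduct_mulVec, ← mulVec_transpose]
    simp only [dotProduct]
    exact Finset.sum_congr rfl fun i _ => by ring

theorem lmin_mul_le {B : M3} (hB : B.PosDef) (v : V3) :
    lmin hB * (v ⬝ᵥ v) ≤ v ⬝ᵥ (B *ᵥ v) := by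
  obtain ⟨w, h1, h2⟩ := hB.1.exists_sum_eigenvalues v
  rw [h1, h2, Finset.mul_sum]
  exact Finset.sum_le_sum fun i _ => mul_le_mul_of_nonneg_right
    (ciInf_le (Set.finite_range _).bddBelow i) (sq_nonneg _)

theorem le_lmax_mul {B : M3} (hB : B.PosDef) (v : V3) :
    v ⬝ᵥ (B *ᵥ v) ≤ lmax hB * (v ⬝ᵥ v) := by
  obtain ⟨w, h1, h2⟩ := hB.1.exists_sum_eigenvalues v
  rw [h1, h2, Finset.mul_sum]
  exact Finset.sum_le_sum fun i _ => mul_le_mul_of_nonneg_right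
    (le_ciSup (Set.finite_range hB.1.eigenvalues).bddAbove i) (sq_nonneg _)

theorem lmin_nonneg {B : M3} (hB : B.PosDef) : 0 ≤ lmin hB :=
  le_ciInf fun i => (hB.eigenvalues_pos i).le

theorem lmax_nonneg {B : M3} (hB : B.PosDef) : 0 ≤ lmax hB :=
  (hB.eigenvalues_pos 0).le.trans
    (le_ciSup (Set.finite_range hB.1.eigenvalues).bddAbove 0)

/-- Derivative of the first integral of the equation `c' = k (1 - c²)`. -/
theorem hasDerivWithinAt_riccati_invariant {c : ℝ → ℝ} {c' k t : ℝ} {s : Set ℝ}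
    (hc : HasDerivWithinAt c c' s t) (h : 0 < c t) :
    HasDerivWithinAt (fun t => (1 - c t) / (1 + c t) * Real.exp (2 * k * t))
      (2 * Real.exp (2 * k * t) / (1 + c t) ^ 2 * (k * (1 - c t ^ 2) - c')) s t := by
  have hne : 1 + c t ≠ 0 := by positivity
  have he : HasDerivWithinAt (fun t => Real.exp (2 * k * t))
      (Real.exp (2 * k * t) * (2 * k * 1)) s t :=
    ((hasDerivAt_id t).const_mul (2 * k)).exp.hasDerivWithinAt
  refine (((hc.const_sub 1).div (hc.const_add 1) hne).mul he).congr_deriv ?_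
  simp only [Pi.div_apply]
  field_simp
  ring

theorem riccati_lower {c c' : ℝ → ℝ} {k : ℝ}
    (hc : ∀ t, 0 ≤ t → HasDerivWithinAt c (c' t) (Set.Ici 0) t) (hpos : ∀ t, 0 ≤ t → 0 < c t)
    (h : ∀ t, 0 ≤ t → k * (1 - c t ^ 2) ≤ c' t) {t : ℝ} (ht : 0 ≤ t) :
    (1 - c t) / (1 + c t) * Real.exp (2 * k * t) ≤ (1 - c 0) / (1 + c 0) := by
  have hd := fun t (ht : 0 ≤ t) => hasDerivWithinAt_riccati_invariant (k := k) (hc t ht) (hpos t ht)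
  have := antitoneOn_of_hasDerivWithinAt_nonpos (convex_Ici (0 : ℝ))
    (fun t ht => (hd t ht).continuousWithinAt)
    (fun t ht => (hd t (interior_subset ht)).mono interior_subset)
    (fun t ht => mul_nonpos_of_nonneg_of_nonpos (by positivity)
      (sub_nonpos.2 (h t (interior_subset ht))))
    (Set.self_mem_Ici) ht ht
  simpa using this

theorem riccati_upper {c c' : ℝ → ℝ} {k : ℝ}
    (hc : ∀ t, 0 ≤ t → HasDerivWithinAt c (c' t) (Set.Ici 0) t) (hpos : ∀ t, 0 ≤ t → 0 < c t)
    (h : ∀ t, 0 ≤ t → c' t ≤ k * (1 - c t ^ 2)) {t : ℝ} (ht : 0 ≤ t) :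
    (1 - c 0) / (1 + c 0) ≤ (1 - c t) / (1 + c t) * Real.exp (2 * k * t) := by
  have hd := fun t (ht : 0 ≤ t) => hasDerivWithinAt_riccati_invariant (k := k) (hc t ht) (hpos t ht)
  have := monotoneOn_of_hasDerivWithinAt_nonneg (convex_Ici (0 : ℝ))
    (fun t ht => (hd t ht).continuousWithinAt)
    (fun t ht => (hd t (interior_subset ht)).mono interior_subset)
    (fun t ht => mul_nonneg (by positivity) (sub_nonneg.2 (h t (interior_subset ht))))
    (Set.self_mem_Ici) ht ht
  simpa using this

/-- The factor `cosh u + c₀ sinh u` satisfies `C² - S² = 1 - c₀²` with `S = sinh u + c₀ cosh u`,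
and the Möbius comparison amounts to comparing `c` with `S / C`. -/
theorem cosh_add_sinh_facts {c₀ c u : ℝ} (h₀ : 0 < c₀) (hc : 0 < c) (hu : 0 ≤ u) :
    ∃ S, 0 < Real.cosh u + c₀ * Real.sinh u ∧ 0 ≤ S ∧
      (Real.cosh u + c₀ * Real.sinh u) ^ 2 - S ^ 2 = 1 - c₀ ^ 2 ∧
      ((1 - c) / (1 + c) * Real.exp (2 * u) ≤ (1 - c₀) / (1 + c₀) →
        S ≤ c * (Real.cosh u + c₀ * Real.sinh u)) ∧
      ((1 - c₀) / (1 + c₀) ≤ (1 - c) / (1 + c) * Real.exp (2 * u) →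
        c * (Real.cosh u + c₀ * Real.sinh u) ≤ S) := by
  have hs := Real.sinh_nonneg_iff.2 hu
  have hch := Real.cosh_pos u
  have hE : Real.exp (2 * u) = (Real.cosh u + Real.sinh u) ^ 2 := by
    rw [Real.cosh_add_sinh, ← Real.exp_nat_mul]; norm_num
  have hid := Real.cosh_sq u
  have hpos : 0 < Real.cosh u + Real.sinh u := by positivity
  have hinv : (Real.cosh u + Real.sinh u) * (Real.cosh u - Real.sinh u) = 1 := by
    linear_combination hid
  have key : (1 - c₀) * (1 + c) - (1 - c) * (Real.cosh u + Real.sinh u) ^ 2 * (1 + c₀) =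
      2 * (Real.cosh u + Real.sinh u) * (c * (Real.cosh u + c₀ * Real.sinh u) -
        (Real.sinh u + c₀ * Real.cosh u)) := by
    linear_combination (-(1 - c₀) * (1 + c)) * hinv
  refine ⟨Real.sinh u + c₀ * Real.cosh u, by positivity, by positivity,
    by linear_combination (1 - c₀ ^ 2) * hid, fun h => ?_, fun h => ?_⟩
  · rw [hE, div_mul_eq_mul_div, div_le_div_iff₀ (by positivity) (by positivity)] at h
    nlinarith
  · rw [hE, div_mul_eq_mul_div, div_le_div_iff₀ (by positivity) (by positivity)] at h
    nlinarith

/-- performance bounds for the Filter II error dynamics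
`R̃' = R̃[σ]ₓ`, `σ = −ψ(AR̃)/(1 + ε − |R̃|_I²)^{1/2}`. -/
theorem stmt13 (A : M3) (hA : A.IsSymm) (hPD : (Abar A).PosDef)
    (ε γ : ℝ) (hε : 0 < ε) (hγ0 : 0 < γ) (hγ : γ < (Real.sqrt (1 + ε))⁻¹)
    (ξ₀ : ℝ) (hξ₀ : ξ₀ = 1 - γ ^ 2 * ε / (1 - γ ^ 2))
    (Rt : ℝ → M3) (σ : ℝ → V3)
    (hσ : ∀ t, σ t = -((Real.sqrt (1 + ε - normI2 (Rt t)))⁻¹ • psi (A * Rt t)))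
    (hSO : ∀ t, 0 ≤ t → SO3 (Rt t))
    (hR' : ∀ t, 0 ≤ t → HasDerivWithinAt Rt (Rt t * skew (σ t)) (Set.Ici 0) t)
    (h0 : normI2 (Rt 0) < ξ₀) (s : ℝ) (hs : s = Real.sqrt (normI2 (Rt 0))) :
    ∀ t, 0 ≤ t →
      s / (Real.cosh (lmax hPD * t) + Real.sqrt (1 - s ^ 2) * Real.sinh (lmax hPD * t)) ≤
        Real.sqrt (normI2 (Rt t)) ∧
      Real.sqrt (normI2 (Rt t)) ≤
        s / (Real.cosh (γ * lmin hPD * t) +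
          Real.sqrt (1 - s ^ 2) * Real.sinh (γ * lmin hPD * t)) := by
  set x : ℝ → ℝ := fun t => normI2 (Rt t) with hx
  set q : ℝ → ℝ := fun t => psi (Rt t) ⬝ᵥ (Abar A *ᵥ psi (Rt t)) with hq
  have hmem (t : ℝ) (ht : 0 ≤ t) : 0 ≤ x t ∧ x t ≤ 1 := (hSO t ht).normI2_mem
  have hqlo (t : ℝ) (ht : 0 ≤ t) : lmin hPD * (4 * (x t * (1 - x t))) ≤ q t := by
    rw [← ((hSO t ht).psi_identities hA).2]
    exact lmin_mul_le hPD _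
  have hqhi (t : ℝ) (ht : 0 ≤ t) : q t ≤ lmax hPD * (4 * (x t * (1 - x t))) := by
    rw [← ((hSO t ht).psi_identities hA).2]
    exact le_lmax_mul hPD _
  have hq0 (t : ℝ) (ht : 0 ≤ t) : 0 ≤ q t :=
    (mul_nonneg (lmin_nonneg hPD) (mul_nonneg (by norm_num)
      (mul_nonneg (hmem t ht).1 (sub_nonneg.2 (hmem t ht).2)))).trans (hqlo t ht)
  have hx' (t : ℝ) (ht : 0 ≤ t) :
      HasDerivWithinAt x (-(q t / (2 * Real.sqrt (1 + ε - x t)))) (Set.Ici 0) t := by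
    convert hasDerivWithinAt_normI2 (hR' t ht) using 1
    rw [trace_mul_skew, hσ, dotProduct_neg, dotProduct_smul, ((hSO t ht).psi_identities hA).1,
      smul_eq_mul]
    ring
  have hanti : AntitoneOn x (Set.Ici 0) :=
    antitoneOn_of_hasDerivWithinAt_nonpos (convex_Ici (0 : ℝ))
      (fun t ht => (hx' t ht).continuousWithinAt)
      (fun t ht => (hx' t (interior_subset ht)).mono interior_subset)
      (fun t ht => neg_nonpos.2 (div_nonneg (hq0 t (interior_subset ht)) (by positivity)))
  have hγ1 : γ ^ 2 < 1 := by
    have : (Real.sqrt (1 + ε))⁻¹ ≤ 1 := inv_le_one_of_one_le₀ (by simp [hε.le])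
    nlinarith
  have hxξ (t : ℝ) (ht : 0 ≤ t) : x t < ξ₀ := (hanti Set.self_mem_Ici ht ht).trans_lt h0
  have hγx (t : ℝ) (ht : 0 ≤ t) : γ ^ 2 * (1 + ε - x t) < 1 - x t := by
    have h1 := hxξ t ht
    rw [hξ₀, lt_sub_comm, div_lt_iff₀ (by linarith)] at h1
    linarith
  have hx1 (t : ℝ) (ht : 0 ≤ t) : x t < 1 := by
    nlinarith [hγx t ht, (hmem t ht).2, sq_pos_of_pos hγ0]
  set c : ℝ → ℝ := fun t => Real.sqrt (1 - x t) with hc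
  have hcpos (t : ℝ) (ht : 0 ≤ t) : 0 < c t := Real.sqrt_pos.2 (by linarith [hx1 t ht])
  have hcsq (t : ℝ) (ht : 0 ≤ t) : c t ^ 2 = 1 - x t := Real.sq_sqrt (by linarith [hx1 t ht])
  set d : ℝ → ℝ := fun t => Real.sqrt (1 + ε - x t) with hd
  have hdpos (t : ℝ) (ht : 0 ≤ t) : 0 < d t := Real.sqrt_pos.2 (by linarith [hx1 t ht])
  have hdsq (t : ℝ) (ht : 0 ≤ t) : d t ^ 2 = 1 + ε - x t :=
    Real.sq_sqrt (by linarith [hx1 t ht])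
  have hγd (t : ℝ) (ht : 0 ≤ t) : γ * d t ≤ c t :=
    Real.le_sqrt_of_sq_le (by rw [mul_pow, hdsq t ht]; exact (hγx t ht).le)
  have hcd (t : ℝ) : c t ≤ d t := Real.sqrt_le_sqrt (by linarith)
  have hc' (t : ℝ) (ht : 0 ≤ t) :
      HasDerivWithinAt c (q t / (4 * c t * d t)) (Set.Ici 0) t := by
    convert ((hx' t ht).const_sub 1).sqrt (by linarith [hx1 t ht]) using 1
    have := (hcpos t ht).ne'
    have := (hdpos t ht).ne'
    change _ = - -(q t / (2 * d t)) / (2 * c t)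
    field_simp
    norm_num
  have hlo (t : ℝ) (ht : 0 ≤ t) : γ * lmin hPD * (1 - c t ^ 2) ≤ q t / (4 * c t * d t) := by
    have h1 := hcpos t ht
    have h2 := hdpos t ht
    rw [le_div_iff₀ (by positivity)]
    refine le_trans ?_ (hqlo t ht)
    rw [hcsq t ht, sub_sub_cancel, ← hcsq t ht]
    have := mul_le_mul_of_nonneg_left (hγd t ht)
      (mul_nonneg (mul_nonneg (lmin_nonneg hPD) (hmem t ht).1) h1.le)
    nlinarith
  have hhi (t : ℝ) (ht : 0 ≤ t) : q t / (4 * c t * d t) ≤ lmax hPD * (1 - c t ^ 2) := by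
    have h1 := hcpos t ht
    have h2 := hdpos t ht
    rw [div_le_iff₀ (by positivity)]
    refine (hqhi t ht).trans ?_
    rw [hcsq t ht, sub_sub_cancel, ← hcsq t ht]
    have := mul_le_mul_of_nonneg_left (hcd t)
      (mul_nonneg (mul_nonneg (lmax_nonneg hPD) (hmem t ht).1) h1.le)
    nlinarith
  have hs2 : s ^ 2 = x 0 := by rw [hs]; exact Real.sq_sqrt (hmem 0 le_rfl).1
  have hs0 : 0 ≤ s := hs ▸ Real.sqrt_nonneg _
  have hc0 : Real.sqrt (1 - s ^ 2) = c 0 := by rw [hs2]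
  intro t ht
  rw [hc0]
  have hsc : 1 - c 0 ^ 2 = s ^ 2 := by rw [hcsq 0 le_rfl, hs2]; ring
  have hct := hcsq t ht
  constructor
  · obtain ⟨S, hC, hS, hCS, -, h⟩ := cosh_add_sinh_facts (hcpos 0 le_rfl) (hcpos t ht)
      (mul_nonneg (lmax_nonneg hPD) ht)
    have h := h (by simpa only [mul_assoc] using riccati_upper hc' hcpos hhi ht)
    refine Real.le_sqrt_of_sq_le ?_
    rw [div_pow, div_le_iff₀ (by positivity)]
    have := pow_le_pow_left₀ (mul_pos (hcpos t ht) hC).le h 2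
    rw [mul_pow, hct] at this
    change _ ≤ x t * _
    linarith
  · obtain ⟨S, hC, hS, hCS, h, -⟩ := cosh_add_sinh_facts (hcpos 0 le_rfl) (hcpos t ht)
      (mul_nonneg (mul_nonneg hγ0.le (lmin_nonneg hPD)) ht)
    have h := h (by simpa only [mul_assoc] using riccati_lower hc' hcpos hlo ht)
    refine Real.sqrt_le_iff.2 ⟨by positivity, ?_⟩
    rw [div_pow, le_div_iff₀ (by positivity)]
    have := pow_le_pow_left₀ hS h 2
    rw [mul_pow, hct] at this
    change x t * _ ≤ _
    linarith

end
end
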